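/- There exists a subgroup G ≤ W isomorphic to the symmetric group S₅ such that: the action of G on the 56 exceptional classes has exactly five orbits, of lengths 10, 10, 12, 12, 12, with point stabilizers isomorphic to the dihedral group of order 12 for the two orbits of length 10 and the dihedral group of order 10 for the three orbits of length 12; G is minimal; G fixes a conic class; and G satisfies condition (H1). -/

import Mathlib

open scoped BigOperators

noncomputable section

/-- The Picard lattice of a degree 2 del Pezzo surface. -/
abbrev V : Type := Fin 8 → ℤ

/-- The intersection form. -/
def bil (x y : V) : ℤ := x 0 * y 0 - ∑ i ∈ Finset.Ioi (0 : Fin 8), x i * y i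

/-- The canonical class. -/
def Kvec : V := fun i => if i = 0 then -3 else 1

abbrev LatAut := V ≃ₗ[ℤ] V

/-- The Weyl group: automorphisms preserving the form and fixing K. -/
def W : Subgroup LatAut where
  carrier := {g | (∀ x y, bil (g x) (g y) = bil x y) ∧ g Kvec = Kvec}
  one_mem' := ⟨fun _ _ => rfl, rfl⟩
  mul_mem' := by
    rintro a b ⟨ha1, ha2⟩ ⟨hb1, hb2⟩
    refine ⟨fun x y => ?_, ?_⟩
    · show bil (a (b x)) (a (b y)) = bil x y
      rw [ha1, hb1]
    · show a (b Kvec) = Kvec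
      rw [hb2, ha2]
  inv_mem' := by
    rintro a ⟨ha1, ha2⟩
    refine ⟨fun x y => ?_, ?_⟩
    · have h := ha1 (a⁻¹ x) (a⁻¹ y)
      have hx : a (a⁻¹ x) = x := a.apply_symm_apply x
      have hy : a (a⁻¹ y) = y := a.apply_symm_apply y
      rw [hx, hy] at h
      exact h.symm
    · have h2 : a.symm (a Kvec) = a.symm Kvec := by rw [ha2]
      rw [a.symm_apply_apply] at h2
      exact (show a⁻¹ Kvec = a.symm Kvec from rfl).trans h2.symm

/-- Exceptional classes. -/
def Exc : Set V := {E | bil E E = -1 ∧ bil E Kvec = -1}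

/-- Conic classes. -/
def IsConic (C : V) : Prop := bil C C = 0 ∧ bil C Kvec = -2

/-- The orbit of a vector under a subgroup of `LatAut`. -/
def orb (G : Subgroup LatAut) (E : V) : Set V := {v | ∃ g ∈ G, g E = v}

/-- The set of orbits of exceptional classes. -/
def orbs (G : Subgroup LatAut) : Set (Set V) := {S | ∃ E ∈ Exc, S = orb G E}

/-- The stabilizer of a vector, as a subgroup of `LatAut`. -/
def stab (G : Subgroup LatAut) (E : V) : Subgroup LatAut where
  carrier := {g | g ∈ G ∧ g E = E}
  one_mem' := ⟨G.one_mem, rfl⟩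
  mul_mem' := by
    rintro a b ⟨haG, ha⟩ ⟨hbG, hb⟩
    exact ⟨G.mul_mem haG hbG, by show a (b E) = E; rw [hb, ha]⟩
  inv_mem' := by
    rintro a ⟨haG, ha⟩
    refine ⟨G.inv_mem haG, ?_⟩
    conv_lhs => rw [← ha]
    exact a.symm_apply_apply E

/-- `G` is minimal: no nonempty orbit of exceptional classes consists of pairwise
orthogonal classes. -/
def MinimalAction (G : Subgroup LatAut) : Prop :=
  ∀ E ∈ Exc, ¬ (∀ E₁ ∈ orb G E, ∀ E₂ ∈ orb G E, E₁ ≠ E₂ → bil E₁ E₂ = 0)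

/-- The natural representation of a subgroup of `LatAut` on the lattice. -/
def rep (G : Subgroup LatAut) : Representation ℤ G V where
  toFun g := (g : LatAut).toLinearMap
  map_one' := rfl
  map_mul' _ _ := rfl

/-- Condition (H1): the first group cohomology of every subgroup of `G`
with coefficients in the lattice vanishes. -/
def CondH1 (G : Subgroup LatAut) : Prop :=
  ∀ G' : Subgroup LatAut, G' ≤ G →
    Subsingleton (groupCohomology.H1 (Rep.of (rep G')))

/-! ### The intersection form and its reflections -/

theorem bil_apply (x y : V) :
    bil x y = x 0 * y 0 - x 1 * y 1 - x 2 * y 2 - x 3 * y 3 - x 4 * y 4 - x 5 * y 5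
      - x 6 * y 6 - x 7 * y 7 := by
  have h : Finset.Ioi (0 : Fin 8) = {1, 2, 3, 4, 5, 6, 7} := by decide
  simp [bil, h]
  ring

theorem bil_comm (x y : V) : bil x y = bil y x := by
  simp only [bil_apply]; ring

theorem bil_add_left (x y z : V) : bil (x + y) z = bil x z + bil y z := by
  simp only [bil_apply, Pi.add_apply]; ring

theorem bil_smul_left (n : ℤ) (x z : V) : bil (n • x) z = n * bil x z := by
  simp only [bil_apply, Pi.smul_apply, smul_eq_mul]; ring

theorem bil_add_right (x y z : V) : bil x (y + z) = bil x y + bil x z := by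
  rw [bil_comm, bil_add_left, bil_comm y, bil_comm z]

theorem bil_smul_right (n : ℤ) (x z : V) : bil x (n • z) = n * bil x z := by
  rw [bil_comm, bil_smul_left, bil_comm z]

/-- The reflection in a root. -/
def rootReflection (r : V) (hr : bil r r = -2) : LatAut :=
  LinearEquiv.ofInvolutive
    { toFun := fun x => x + bil x r • r
      map_add' := fun x y => by rw [bil_add_left, add_smul]; abel
      map_smul' := fun n x => by
        rw [bil_smul_left, mul_smul, smul_add, RingHom.id_apply] }
    (fun x => by
      change x + bil x r • r + bil (x + bil x r • r) r • r = x
      rw [bil_add_left, bil_smul_left, hr]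
      module)

theorem rootReflection_apply (r : V) (hr : bil r r = -2) (x : V) :
    rootReflection r hr x = x + bil x r • r := rfl

theorem rootReflection_mem_W (r : V) (hr : bil r r = -2) (hK : bil Kvec r = 0) :
    rootReflection r hr ∈ W := by
  refine ⟨fun x y => ?_, ?_⟩
  · simp only [rootReflection_apply, bil_add_left, bil_add_right, bil_smul_left,
      bil_smul_right, hr, bil_comm r]
    ring
  · rw [rootReflection_apply, hK, zero_smul, add_zero]

/-! ### Vectors permuted by the symmetric group -/

/-- The invariant conic class. -/
def conicVec : V := ![1, -1, 0, 0, 0, 0, 0, 0]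

/-- Ten exceptional classes, labelled by the unordered pairs of distinct elements of `Fin 5`. -/
def pairVec : Fin 5 → Fin 5 → V :=
  ![![0, ![1, 0, 0, -1, 0, 0, -1, 0], ![2, -1, -1, 0, -1, -1, -1, 0],
      ![2, -1, -1, -1, 0, -1, 0, -1], ![1, 0, 0, 0, -1, 0, 0, -1]],
    ![![1, 0, 0, -1, 0, 0, -1, 0], 0, ![1, 0, 0, 0, 0, -1, 0, -1],
      ![2, -1, -1, 0, -1, 0, -1, -1], ![2, -1, -1, -1, -1, -1, 0, 0]],
    ![![2, -1, -1, 0, -1, -1, -1, 0], ![1, 0, 0, 0, 0, -1, 0, -1], 0,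
      ![1, 0, 0, -1, -1, 0, 0, 0], ![2, -1, -1, -1, 0, 0, -1, -1]],
    ![![2, -1, -1, -1, 0, -1, 0, -1], ![2, -1, -1, 0, -1, 0, -1, -1],
      ![1, 0, 0, -1, -1, 0, 0, 0], 0, ![1, 0, 0, 0, 0, -1, -1, 0]],
    ![![1, 0, 0, 0, -1, 0, 0, -1], ![2, -1, -1, -1, -1, -1, 0, 0],
      ![2, -1, -1, -1, 0, 0, -1, -1], ![1, 0, 0, 0, 0, -1, -1, 0], 0]]

/-- Two conic classes, exchanged by the odd permutations. -/
def signVec (ε : ℤˣ) : V :=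
  if ε = 1 then ![1, 0, -1, 0, 0, 0, 0, 0] else ![3, -2, 0, -1, -1, -1, -1, -1]

/-- For each adjacent transposition, three orthogonal roots. -/
def swapRoot : Fin 4 → Fin 3 → V :=
  ![![![0, 0, -1, 0, 0, 0, 0, 1], ![-1, 1, 0, 1, 0, 1, 0, 0], ![-1, 1, 0, 0, 1, 0, 1, 0]],
    ![![0, 0, -1, 1, 0, 0, 0, 0], ![-1, 1, 0, 0, 1, 1, 0, 0], ![-1, 1, 0, 0, 0, 0, 1, 1]],
    ![![0, 0, -1, 0, 0, 1, 0, 0], ![-1, 1, 0, 1, 0, 0, 0, 1], ![-1, 1, 0, 0, 1, 0, 1, 0]],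
    ![![0, 0, -1, 0, 1, 0, 0, 0], ![-1, 1, 0, 1, 0, 1, 0, 0], ![-1, 1, 0, 0, 0, 0, 1, 1]]]

/-- `g` acts on the labelled vectors through the permutation `σ`. -/
def ActsAs (g : LatAut) (σ : Equiv.Perm (Fin 5)) : Prop :=
  g ∈ W ∧ g conicVec = conicVec ∧ (∀ i j, g (pairVec i j) = pairVec (σ i) (σ j)) ∧
    ∀ ε, g (signVec ε) = signVec (Equiv.Perm.sign σ * ε)

theorem ActsAs.one : ActsAs 1 1 :=
  ⟨W.one_mem, rfl, fun _ _ => rfl, fun ε => by simp⟩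

theorem ActsAs.mul {g h : LatAut} {σ τ : Equiv.Perm (Fin 5)} (hg : ActsAs g σ)
    (hh : ActsAs h τ) : ActsAs (g * h) (σ * τ) := by
  refine ⟨W.mul_mem hg.1 hh.1, ?_, fun i j => ?_, fun ε => ?_⟩
  · rw [LinearEquiv.mul_apply, hh.2.1, hg.2.1]
  · rw [LinearEquiv.mul_apply, hh.2.2.1, hg.2.2.1]; rfl
  · rw [LinearEquiv.mul_apply, hh.2.2.2, hg.2.2.2, map_mul, mul_assoc]

theorem eq_zero_of_bil_eq_zero (x : V) (hC : bil x conicVec = 0) (hK : bil x Kvec = 0)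
    (hq : bil x (signVec 1) = 0) (hp : ∀ i j, bil x (pairVec i j) = 0) : x = 0 := by
  have h01 := hp 0 1
  have h02 := hp 0 2
  have h03 := hp 0 3
  have h04 := hp 0 4
  have h12 := hp 1 2
  have h13 := hp 1 3
  simp [bil_apply, conicVec, Kvec, signVec, pairVec] at hC hK hq h01 h02 h03 h04 h12 h13
  ext i
  fin_cases i <;> simp <;> omega

theorem ActsAs.unique {g h : LatAut} {σ : Equiv.Perm (Fin 5)} (hg : ActsAs g σ)
    (hh : ActsAs h σ) : g = h := by
  refine LinearEquiv.ext fun x => ?_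
  have key : ∀ v, g v = h v → bil (g x - h x) (h v) = 0 := fun v hv => by
    rw [sub_eq_add_neg, ← neg_one_smul ℤ (h x), bil_add_left, bil_smul_left, hh.1.1, ← hv, hg.1.1]
    ring
  refine sub_eq_zero.1 (eq_zero_of_bil_eq_zero _ ?_ ?_ ?_ fun i j => ?_)
  · simpa only [hh.2.1] using key conicVec (hg.2.1.trans hh.2.1.symm)
  · simpa only [hh.1.2] using key Kvec (hg.1.2.trans hh.1.2.symm)
  · have := key (signVec (Equiv.Perm.sign σ)) ((hg.2.2.2 _).trans (hh.2.2.2 _).symm)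
    rwa [hh.2.2.2, Int.units_mul_self] at this
  · have := key (pairVec (σ.symm i) (σ.symm j)) ((hg.2.2.1 _ _).trans (hh.2.2.1 _ _).symm)
    rwa [hh.2.2.1, σ.apply_symm_apply, σ.apply_symm_apply] at this

theorem bil_swapRoot_self : ∀ k a, bil (swapRoot k a) (swapRoot k a) = -2 := by
  decide +kernel

theorem actsAs_swap (k : Fin 4) :
    ActsAs (rootReflection (swapRoot k 0) (bil_swapRoot_self k 0) *
      rootReflection (swapRoot k 1) (bil_swapRoot_self k 1) *
      rootReflection (swapRoot k 2) (bil_swapRoot_self k 2))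
      (Equiv.swap k.castSucc k.succ) := by
  have hK : ∀ k a, bil Kvec (swapRoot k a) = 0 := by decide +kernel
  have hC : ∀ k a, bil conicVec (swapRoot k a) = 0 := by decide +kernel
  refine ⟨W.mul_mem (W.mul_mem ?_ ?_) ?_, ?_, ?_, ?_⟩
  · exact rootReflection_mem_W _ _ (hK _ _)
  · exact rootReflection_mem_W _ _ (hK _ _)
  · exact rootReflection_mem_W _ _ (hK _ _)
  · simp only [LinearEquiv.mul_apply, rootReflection_apply, hC, zero_smul, add_zero]
  · simp only [LinearEquiv.mul_apply, rootReflection_apply]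
    revert k
    decide +kernel
  · simp only [LinearEquiv.mul_apply, rootReflection_apply]
    revert k
    decide +kernel

theorem exists_actsAs (σ : Equiv.Perm (Fin 5)) : ∃ g, ActsAs g σ := by
  have hσ : σ ∈ Submonoid.closure
      (Set.range fun k : Fin 4 => Equiv.swap k.castSucc k.succ) := by
    rw [Equiv.Perm.mclosure_swap_castSucc_succ]; trivial
  induction hσ using Submonoid.closure_induction with
  | mem _ h =>
    obtain ⟨k, rfl⟩ := h
    exact ⟨_, actsAs_swap k⟩
  | one => exact ⟨1, .one⟩
  | mul _ _ _ _ h₁ h₂ =>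
    obtain ⟨g, hg⟩ := h₁
    obtain ⟨h, hh⟩ := h₂
    exact ⟨g * h, hg.mul hh⟩

/-- The action of the symmetric group on the lattice. -/
def symRep : Equiv.Perm (Fin 5) →* LatAut :=
  MonoidHom.mk' (fun σ => (exists_actsAs σ).choose) fun σ τ =>
    (exists_actsAs (σ * τ)).choose_spec.unique
      ((exists_actsAs σ).choose_spec.mul (exists_actsAs τ).choose_spec)

theorem symRep_actsAs (σ : Equiv.Perm (Fin 5)) : ActsAs (symRep σ) σ :=
  (exists_actsAs σ).choose_spec

theorem symRep_injective : Function.Injective symRep := by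
  refine (injective_iff_map_eq_one _).2 fun σ hσ => ?_
  have h : ∀ i j, pairVec (σ i) (σ j) = pairVec i j := fun i j => by
    rw [← (symRep_actsAs σ).2.2.1, hσ]; rfl
  have hp : ∀ i j k l : Fin 5, i ≠ j → pairVec k l = pairVec i j →
      k = i ∧ l = j ∨ k = j ∧ l = i := by decide +kernel
  refine Equiv.ext fun i => ?_
  change σ i = i
  have hne : ∀ i : Fin 5, i ≠ i + 1 ∧ i ≠ i + 2 ∧ i + 1 ≠ i + 2 := by decide
  obtain ⟨h₁, h₂, h₃⟩ := hne i
  have a := hp _ _ _ _ h₁ (h i (i + 1))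
  have b := hp _ _ _ _ h₂ (h i (i + 2))
  grind

/-! ### Orbits and stabilizers -/

theorem orb_eq_orbit (G : Subgroup LatAut) (E : V) : orb G E = MulAction.orbit G E := by
  ext v
  exact ⟨fun ⟨g, hg, h⟩ => ⟨⟨g, hg⟩, h⟩, fun ⟨g, h⟩ => ⟨g, g.2, h⟩⟩

theorem orb_eq_of_mem {G : Subgroup LatAut} {E E' : V} (h : E' ∈ orb G E) :
    orb G E' = orb G E := by
  rw [orb_eq_orbit] at *
  rw [orb_eq_orbit]
  exact MulAction.orbit_eq_iff.2 h

theorem stab_eq_map_stabilizer (G : Subgroup LatAut) (E : V) :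
    stab G E = (MulAction.stabilizer G E).map G.subtype := by
  ext g
  constructor
  · rintro ⟨hg, h⟩
    exact ⟨⟨g, hg⟩, h, rfl⟩
  · rintro ⟨g, h, rfl⟩
    exact ⟨g.2, h⟩

theorem ncard_orb_mul_card_stab (G : Subgroup LatAut) (E : V) :
    (orb G E).ncard * Nat.card (stab G E) = Nat.card G := by
  rw [orb_eq_orbit, ← MulAction.index_stabilizer, stab_eq_map_stabilizer,
    Subgroup.card_map_of_injective G.subtype_injective, Subgroup.index_mul_card]

theorem mem_orb_range {E v : V} :
    v ∈ orb symRep.range E ↔ ∃ σ, symRep σ E = v :=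
  ⟨fun ⟨_, ⟨σ, h⟩, h'⟩ => ⟨σ, h ▸ h'⟩, fun ⟨σ, h⟩ => ⟨_, ⟨σ, rfl⟩, h⟩⟩

theorem card_range_symRep : Nat.card symRep.range = 120 := by
  rw [← Nat.card_congr (MonoidHom.ofInjective symRep_injective).toEquiv, Nat.card_perm,
    Nat.card_fin]
  rfl

/-- A group embedded in the stabilizer of `E₀` and of the right order is the stabilizer of every
vector in the orbit of `E₀`. -/
theorem nonempty_stab_mulEquiv {D : Type*} [Group D] {δ : D →* Equiv.Perm (Fin 5)}
    (hδ : Function.Injective δ) {E₀ E : V} (hfix : ∀ d, symRep (δ d) E₀ = E₀)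
    (hcard : (orb symRep.range E₀).ncard * Nat.card D = 120) (hE : E ∈ orb symRep.range E₀) :
    Nonempty (stab symRep.range E ≃* D) := by
  obtain ⟨τ, rfl⟩ := mem_orb_range.1 hE
  have hmem : ∀ d, symRep (MulAut.conj τ (δ d)) ∈ stab symRep.range (symRep τ E₀) := fun d => by
    refine ⟨⟨_, rfl⟩, ?_⟩
    rw [← LinearEquiv.mul_apply, ← map_mul, MulAut.conj_apply, inv_mul_cancel_right, map_mul,
      LinearEquiv.mul_apply, hfix]
  let φ : D →* stab symRep.range (symRep τ E₀) :=
    (symRep.comp ((MulAut.conj τ).toMonoidHom.comp δ)).codRestrict _ hmem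
  have hφ : Function.Injective φ := fun a b h =>
    hδ ((MulAut.conj τ).injective (symRep_injective (congrArg Subtype.val h)))
  have hs := ncard_orb_mul_card_stab symRep.range (symRep τ E₀)
  rw [orb_eq_of_mem hE, card_range_symRep, ← hcard] at hs
  have hpos : 0 < (orb symRep.range E₀).ncard := by
    by_contra h
    simp [Nat.eq_zero_of_not_pos h] at hcard
  have hc := Nat.eq_of_mul_eq_mul_left hpos hs
  have : Finite (stab symRep.range (symRep τ E₀)) := by
    refine (Nat.card_ne_zero.1 ?_).2
    rw [hc]
    intro h
    simp [h] at hcard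
  exact ⟨(MulEquiv.ofBijective φ
    ((Nat.bijective_iff_injective_and_card φ).2 ⟨hφ, hc.symm⟩)).symm⟩

/-! ### The five orbits of exceptional classes -/

/-- The class attached to the pentagon `0 — 1 — 2 — 3 — 4 — 0`: a component of a singular fibre
of the invariant conic bundle. -/
def pentVec : V := ![0, 0, 1, 0, 0, 0, 0, 0]

/-- A section of the invariant conic bundle. -/
def sectionVec : V := ![0, 1, 0, 0, 0, 0, 0, 0]

theorem three_smul_symRep_pentVec (τ : Equiv.Perm (Fin 5)) :
    (3 : ℤ) • symRep τ pentVec = ∑ i, pairVec (τ i) (τ (i + 1)) - signVec (Equiv.Perm.sign τ)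
      + (2 : ℤ) • conicVec + (2 : ℤ) • Kvec := by
  have h : (3 : ℤ) • pentVec = ∑ i, pairVec i (i + 1) - signVec 1
      + (2 : ℤ) • conicVec + (2 : ℤ) • Kvec := by decide +kernel
  obtain ⟨hW, hC, hp, hq⟩ := symRep_actsAs τ
  rw [← map_smul, h]
  simp only [map_add, map_sub, map_sum, map_smul, hC, hp, hq, hW.2, mul_one]

theorem three_smul_symRep_sectionVec (τ : Equiv.Perm (Fin 5)) :
    (3 : ℤ) • symRep τ sectionVec = ∑ i, pairVec (τ i) (τ (i + 1))
      + (2 : ℤ) • signVec (Equiv.Perm.sign τ) - conicVec + (2 : ℤ) • Kvec := by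
  have h : sectionVec = pentVec + signVec 1 - conicVec := by decide +kernel
  obtain ⟨hW, hC, hp, hq⟩ := symRep_actsAs τ
  rw [h, map_sub, map_add, hC, hq, mul_one, smul_sub, smul_add, three_smul_symRep_pentVec]
  module

theorem orb_eq_coe {E : V} {X : Finset V} {Ψ : Equiv.Perm (Fin 5) → V} {n : ℤ} (hn : n ≠ 0)
    (hE : ∀ τ, n • symRep τ E = Ψ τ) (h₁ : ∀ τ, ∃ e ∈ X, n • e = Ψ τ)
    (h₂ : ∀ e ∈ X, ∃ τ, n • e = Ψ τ) : orb symRep.range E = X := by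
  ext v
  rw [mem_orb_range, Finset.mem_coe]
  constructor
  · rintro ⟨τ, rfl⟩
    obtain ⟨e, he, h⟩ := h₁ τ
    rwa [← smul_right_injective V hn (h.trans (hE τ).symm)]
  · intro hv
    obtain ⟨τ, h⟩ := h₂ v hv
    exact ⟨τ, smul_right_injective V hn ((hE τ).trans h.symm)⟩

/-- The Geiser involution on exceptional classes. -/
def geiser (E : V) : V := -Kvec - E

theorem symRep_geiser (σ : Equiv.Perm (Fin 5)) (E : V) :
    symRep σ (geiser E) = geiser (symRep σ E) := by
  rw [geiser, map_sub, map_neg, (symRep_actsAs σ).1.2, geiser]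

/-- The orbit of exceptional classes labelled by pairs. -/
def pairOrbit : Finset V :=
  (Finset.univ.filter fun x : Fin 5 × Fin 5 => x.1 < x.2).image fun x => pairVec x.1 x.2

/-- The orbit of the components of singular fibres of the invariant conic bundle. -/
def fibreOrbit : Finset V :=
  (Finset.Ioi 1).image (fun i : Fin 8 => Pi.single i 1) ∪
    (Finset.Ioi 1).image (fun i : Fin 8 => conicVec - Pi.single i 1)

/-- The orbit of sections of the invariant conic bundle stable under the Geiser involution. -/
def sectionOrbit : Finset V :=
  let Y := insert sectionVec
    ((Finset.Ioi 2).image fun i : Fin 8 => signVec 1 - Pi.single i 1)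
  Y ∪ Y.image geiser

theorem orb_pairVec : orb symRep.range (pairVec 0 1) = pairOrbit :=
  orb_eq_coe (n := 1) one_ne_zero (Ψ := fun τ => pairVec (τ 0) (τ 1))
    (fun τ => by rw [one_smul, (symRep_actsAs τ).2.2.1]) (by decide +kernel) (by decide +kernel)

theorem orb_pentVec : orb symRep.range pentVec = fibreOrbit :=
  orb_eq_coe three_ne_zero three_smul_symRep_pentVec (by decide +kernel) (by decide +kernel)

theorem orb_sectionVec : orb symRep.range sectionVec = sectionOrbit :=
  orb_eq_coe three_ne_zero three_smul_symRep_sectionVec (by decide +kernel) (by decide +kernel)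

theorem orb_geiser {E : V} {X : Finset V} (h : orb symRep.range E = X) :
    orb symRep.range (geiser E) = X.image geiser := by
  ext v
  rw [mem_orb_range, Finset.mem_coe, Finset.mem_image]
  constructor
  · rintro ⟨σ, rfl⟩
    refine ⟨symRep σ E, ?_, (symRep_geiser σ E).symm⟩
    rw [← Finset.mem_coe, ← h, mem_orb_range]
    exact ⟨σ, rfl⟩
  · rintro ⟨e, he, rfl⟩
    rw [← Finset.mem_coe, ← h, mem_orb_range] at he
    obtain ⟨σ, rfl⟩ := he
    exact ⟨σ, symRep_geiser σ E⟩

/-- Representatives of the five orbits of exceptional classes. -/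
def orbitRep : Fin 5 → V :=
  ![pairVec 0 1, geiser (pairVec 0 1), pentVec, geiser pentVec, sectionVec]

/-- The five orbits of exceptional classes. -/
def excOrbit : Fin 5 → Finset V :=
  ![pairOrbit, pairOrbit.image geiser, fibreOrbit, fibreOrbit.image geiser, sectionOrbit]

theorem orb_orbitRep (k : Fin 5) : orb symRep.range (orbitRep k) = excOrbit k := by
  fin_cases k
  · exact orb_pairVec
  · exact orb_geiser orb_pairVec
  · exact orb_pentVec
  · exact orb_geiser orb_pentVec
  · exact orb_sectionVec

theorem card_excOrbit : ∀ k, (excOrbit k).card = if k < 2 then 10 else 12 := by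
  decide +kernel

theorem coe_excOrbit_injective : Function.Injective fun k => (excOrbit k : Set V) := by
  have h : ∀ k l, orbitRep k ∈ excOrbit l → k = l := by decide +kernel
  have h' : ∀ k, orbitRep k ∈ excOrbit k := by decide +kernel
  exact fun k l hkl => h k l (Finset.coe_injective hkl ▸ h' k)

theorem orbitRep_mem_Exc (k : Fin 5) : orbitRep k ∈ Exc := by
  change bil _ _ = -1 ∧ bil _ _ = -1
  revert k
  decide +kernel

theorem exists_mem_excOrbit_of_shift (a : ℤ) (c : Fin 4) (ha : a = ![0, -1, -1, -2] c) (E : V)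
    (hc : E 0 = c.val) (h : ∀ i, i ≠ 0 → E i = a ∨ E i = a + 1) (hE : E ∈ Exc) :
    ∃ k, E ∈ excOrbit k := by
  have key : ∀ (c : Fin 4) (b₁ b₂ b₃ b₄ b₅ b₆ b₇ : Fin 2),
      (b₁.val + b₂.val + b₃.val + b₄.val + b₅.val + b₆.val + b₇.val = ![1, 5, 2, 6] c) →
      ∃ k, (![c.val, ![0, -1, -1, -2] c + b₁.val, ![0, -1, -1, -2] c + b₂.val,
        ![0, -1, -1, -2] c + b₃.val, ![0, -1, -1, -2] c + b₄.val, ![0, -1, -1, -2] c + b₅.val,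
        ![0, -1, -1, -2] c + b₆.val, ![0, -1, -1, -2] c + b₇.val] : V) ∈ excOrbit k := by
    decide +kernel
  have hb : ∀ i, ∃ b : Fin 2, i ≠ 0 → E i = a + b.val := fun i => by
    by_cases hi : i = 0
    · exact ⟨0, fun h => absurd hi h⟩
    · rcases h i hi with h | h
      · exact ⟨0, fun _ => by simpa using h⟩
      · exact ⟨1, fun _ => by simpa using h⟩
  choose b hb using hb
  have hE' : E = ![(c.val : ℤ), a + (b 1).val, a + (b 2).val, a + (b 3).val, a + (b 4).val,
      a + (b 5).val, a + (b 6).val, a + (b 7).val] := by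
    ext i
    fin_cases i
    · exact hc
    all_goals exact hb _ (by decide)
  have hK : bil E Kvec = -1 := hE.2
  rw [hE', ha]
  refine key c _ _ _ _ _ _ _ ?_
  rw [hE', bil_apply] at hK
  subst ha
  simp [Kvec] at hK
  fin_cases c <;> simp at hK ⊢ <;> omega

theorem exists_mem_excOrbit {E : V} (hE : E ∈ Exc) : ∃ k, E ∈ excOrbit k := by
  have h₁ : bil E E = -1 := hE.1
  have h₂ : bil E Kvec = -1 := hE.2
  rw [bil_apply] at h₁ h₂
  simp [Kvec] at h₂
  have hsq : (7 * E 1 - (1 - 3 * E 0)) ^ 2 + (7 * E 2 - (1 - 3 * E 0)) ^ 2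
      + (7 * E 3 - (1 - 3 * E 0)) ^ 2 + (7 * E 4 - (1 - 3 * E 0)) ^ 2
      + (7 * E 5 - (1 - 3 * E 0)) ^ 2 + (7 * E 6 - (1 - 3 * E 0)) ^ 2
      + (7 * E 7 - (1 - 3 * E 0)) ^ 2 = 7 * (6 + 6 * E 0 - 2 * E 0 ^ 2) := by
    linear_combination (-49) * h₁ + 14 * (1 - 3 * E 0) * h₂
  have hb : 0 ≤ 6 + 6 * E 0 - 2 * E 0 ^ 2 := by
    have : 0 ≤ 7 * (6 + 6 * E 0 - 2 * E 0 ^ 2) := hsq ▸ by positivity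
    omega
  have hbd : ∀ t : ℤ, 0 ≤ 6 + 6 * t - 2 * t ^ 2 → 0 ≤ t ∧ t ≤ 3 := fun t ht =>
    ⟨by by_contra! h; nlinarith, by by_contra! h; nlinarith⟩
  obtain ⟨hlo, hhi⟩ := hbd _ hb
  have hnn : ∀ t : ℤ, 0 ≤ t * (t - 1) := fun t => by
    rcases le_or_gt t 0 with h | h
    · exact mul_nonneg_of_nonpos_of_nonpos h (by omega)
    · exact mul_nonneg h.le (by omega)
  have hshift : ∀ a : ℤ, (E 1 - a) * (E 1 - a - 1) + (E 2 - a) * (E 2 - a - 1)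
      + (E 3 - a) * (E 3 - a - 1) + (E 4 - a) * (E 4 - a - 1) + (E 5 - a) * (E 5 - a - 1)
      + (E 6 - a) * (E 6 - a - 1) + (E 7 - a) * (E 7 - a - 1) = 0 →
      ∀ i, i ≠ 0 → E i = a ∨ E i = a + 1 := fun a h i hi => by
    have h1 := hnn (E 1 - a)
    have h2 := hnn (E 2 - a)
    have h3 := hnn (E 3 - a)
    have h4 := hnn (E 4 - a)
    have h5 := hnn (E 5 - a)
    have h6 := hnn (E 6 - a)
    have h7 := hnn (E 7 - a)
    have h0 : (E i - a) * (E i - a - 1) = 0 := by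
      fin_cases i
      · exact absurd rfl hi
      all_goals simp only [Fin.mk_one, Fin.reduceFinMk]; linarith
    rcases mul_eq_zero.1 h0 with h | h
    · left; omega
    · right; omega
  obtain h | h | h | h : E 0 = 0 ∨ E 0 = 1 ∨ E 0 = 2 ∨ E 0 = 3 := by omega
  · exact exists_mem_excOrbit_of_shift 0 0 rfl E h
      (hshift _ (by rw [h] at h₁ h₂; linear_combination (-1) * h₁ + h₂)) hE
  · exact exists_mem_excOrbit_of_shift (-1) 1 rfl E h
      (hshift _ (by rw [h] at h₁ h₂; linear_combination (-1) * h₁ - h₂)) hE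
  · exact exists_mem_excOrbit_of_shift (-1) 2 rfl E h
      (hshift _ (by rw [h] at h₁ h₂; linear_combination (-1) * h₁ - h₂)) hE
  · exact exists_mem_excOrbit_of_shift (-2) 3 rfl E h
      (hshift _ (by rw [h] at h₁ h₂; linear_combination (-1) * h₁ - 3 * h₂)) hE

theorem exists_orb_eq {E : V} (hE : E ∈ Exc) :
    ∃ k, E ∈ orb symRep.range (orbitRep k) ∧ orb symRep.range E = excOrbit k := by
  obtain ⟨k, hk⟩ := exists_mem_excOrbit hE
  have : E ∈ orb symRep.range (orbitRep k) := by rwa [orb_orbitRep]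
  exact ⟨k, this, (orb_eq_of_mem this).trans (orb_orbitRep k)⟩

theorem orbs_range_symRep :
    orbs symRep.range = Set.range fun k => (excOrbit k : Set V) := by
  ext S
  constructor
  · rintro ⟨E, hE, rfl⟩
    obtain ⟨k, -, hk⟩ := exists_orb_eq hE
    exact ⟨k, hk.symm⟩
  · rintro ⟨k, rfl⟩
    exact ⟨_, orbitRep_mem_Exc k, (orb_orbitRep k).symm⟩

theorem ncard_orbs : (orbs symRep.range).ncard = 5 := by
  rw [orbs_range_symRep, ← Set.image_univ, Set.ncard_image_of_injective _
    coe_excOrbit_injective, Set.ncard_univ, Nat.card_fin]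

theorem ncard_orbs_filter (n : ℕ) :
    {S ∈ orbs symRep.range | S.ncard = n}.ncard =
      (Finset.univ.filter fun k : Fin 5 => (if k < 2 then 10 else 12) = n).card := by
  have : {S ∈ orbs symRep.range | S.ncard = n} = (fun k => (excOrbit k : Set V)) ''
      ((Finset.univ.filter fun k : Fin 5 => (if k < 2 then 10 else 12) = n) : Set (Fin 5)) := by
    rw [orbs_range_symRep]
    ext S
    constructor
    · rintro ⟨⟨k, rfl⟩, hk⟩
      refine ⟨k, ?_, rfl⟩
      rw [Set.ncard_coe_finset, card_excOrbit] at hk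
      simpa using hk
    · rintro ⟨k, hk, rfl⟩
      refine ⟨⟨k, rfl⟩, ?_⟩
      rw [Set.ncard_coe_finset, card_excOrbit]
      simpa using hk
  rw [this, Set.ncard_image_of_injective _ coe_excOrbit_injective,
    Set.ncard_coe_finset]

theorem minimalAction_range_symRep : MinimalAction symRep.range := by
  have h : ∀ k, ∃ E₁ ∈ excOrbit k, ∃ E₂ ∈ excOrbit k, E₁ ≠ E₂ ∧ bil E₁ E₂ ≠ 0 := by
    decide +kernel
  intro E hE hperp
  obtain ⟨k, -, hk⟩ := exists_orb_eq hE
  obtain ⟨E₁, h₁, E₂, h₂, hne, hb⟩ := h k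
  rw [hk] at hperp
  exact hb (hperp E₁ h₁ E₂ h₂ hne)

/-! ### Point stabilizers -/

/-- The dihedral group of order 12 as the stabilizer of the pair `{0, 1}`. -/
def pairDihedral : DihedralGroup 6 →* Equiv.Perm (Fin 5) :=
  let a : Equiv.Perm (Fin 5) := Equiv.swap 0 1 * (Equiv.swap 2 3 * Equiv.swap 3 4)
  MonoidHom.mk' (fun
    | .r k => a ^ k.val
    | .sr k => Equiv.swap 2 3 * a ^ k.val) (by decide +kernel)

/-- The dihedral group of order 10 as the symmetry group of a pentagon. -/
def pentDihedral : DihedralGroup 5 →* Equiv.Perm (Fin 5) :=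
  MonoidHom.mk' (fun
    | .r k => finRotate 5 ^ k.val
    | .sr k => Equiv.neg (Fin 5) * finRotate 5 ^ k.val) (by decide +kernel)

theorem pairDihedral_injective : Function.Injective pairDihedral := by
  unfold Function.Injective
  decide +kernel

theorem pentDihedral_injective : Function.Injective pentDihedral := by
  unfold Function.Injective
  decide +kernel

theorem symRep_pairDihedral (d : DihedralGroup 6) :
    symRep (pairDihedral d) (pairVec 0 1) = pairVec 0 1 := by
  rw [(symRep_actsAs _).2.2.1]
  revert d
  decide +kernel

theorem symRep_pentDihedral (d : DihedralGroup 5) :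
    symRep (pentDihedral d) pentVec = pentVec := by
  refine smul_right_injective V (three_ne_zero (α := ℤ)) ?_
  beta_reduce
  rw [three_smul_symRep_pentVec]
  revert d
  decide +kernel

theorem symRep_pentDihedral_sectionVec (d : DihedralGroup 5) :
    symRep (pentDihedral d) sectionVec = sectionVec := by
  refine smul_right_injective V (three_ne_zero (α := ℤ)) ?_
  beta_reduce
  rw [three_smul_symRep_sectionVec]
  revert d
  decide +kernel

theorem nonempty_stab_mulEquiv_pair {k : Fin 5} (hk : k < 2) {E : V}
    (hE : E ∈ orb symRep.range (orbitRep k)) :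
    Nonempty (stab symRep.range E ≃* DihedralGroup 6) := by
  refine nonempty_stab_mulEquiv pairDihedral_injective (fun d => ?_) ?_ hE
  · obtain rfl | rfl : k = 0 ∨ k = 1 := by omega
    · exact symRep_pairDihedral d
    · exact (symRep_geiser _ _).trans (congrArg geiser (symRep_pairDihedral d))
  · rw [orb_orbitRep, Set.ncard_coe_finset, card_excOrbit, if_pos hk, DihedralGroup.nat_card]

theorem nonempty_stab_mulEquiv_pent {k : Fin 5} (hk : ¬ k < 2) {E : V}
    (hE : E ∈ orb symRep.range (orbitRep k)) :
    Nonempty (stab symRep.range E ≃* DihedralGroup 5) := by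
  refine nonempty_stab_mulEquiv pentDihedral_injective (fun d => ?_) ?_ hE
  · obtain rfl | rfl | rfl : k = 2 ∨ k = 3 ∨ k = 4 := by omega
    · exact symRep_pentDihedral d
    · exact (symRep_geiser _ _).trans (congrArg geiser (symRep_pentDihedral d))
    · exact symRep_pentDihedral_sectionVec d
  · rw [orb_orbitRep, Set.ncard_coe_finset, card_excOrbit, if_neg hk, DihedralGroup.nat_card]

/-! ### Vanishing of cohomology -/

/-- The bilinear form as a linear functional in the first variable. -/
def bilRight (y : V) : V →ₗ[ℤ] ℤ where
  toFun x := bil x y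
  map_add' x x' := bil_add_left x x' y
  map_smul' n x := bil_smul_left n x y

/-- The operator `x ↦ ∑ ⟨x, e⟩ e`. -/
def frameOp (X : Finset V) : V →ₗ[ℤ] V := ∑ e ∈ X, (bilRight e).smulRight e

theorem frameOp_apply (X : Finset V) (x : V) : frameOp X x = ∑ e ∈ X, bil x e • e := by
  simp [frameOp, bilRight]

/-- The pair of conic classes exchanged by odd permutations. -/
def signOrbit : Finset V := {signVec 1, signVec (-1)}

/-- Modulo invariant vectors, the lattice is a direct summand of a permutation module. -/
theorem eq_frameOp (x : V) :
    x = frameOp fibreOrbit x - frameOp pairOrbit x - frameOp signOrbit x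
      - (3 * bil x conicVec + bil x Kvec) • conicVec
      + (3 * bil x Kvec - bil x conicVec) • Kvec := by
  have h : LinearMap.id = frameOp fibreOrbit - frameOp pairOrbit - frameOp signOrbit
      - ((3 : ℤ) • bilRight conicVec + bilRight Kvec).smulRight conicVec
      + ((3 : ℤ) • bilRight Kvec - bilRight conicVec).smulRight Kvec := by
    refine (Pi.basisFun ℤ (Fin 8)).ext fun i => ?_
    simp only [Pi.basisFun_apply, LinearMap.id_apply, LinearMap.add_apply, LinearMap.sub_apply,
      LinearMap.smulRight_apply, LinearMap.smul_apply, frameOp_apply, smul_eq_mul]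
    revert i
    decide +kernel
  exact LinearMap.congr_fun h x

section Cocycle

variable {G : Subgroup LatAut} {f : G → V}

theorem bil_cocycle_eq_zero [Finite G] (hG : G ≤ W)
    (hf : ∀ g h : G, f (g * h) = g.1 (f h) + f g) {v : V} {s : G} (hs : s.1 v = v) :
    bil (f s) v = 0 := by
  have hpow : ∀ n : ℕ, (s ^ n : G).1 v = v ∧ bil (f (s ^ n)) v = n * bil (f s) v := by
    intro n
    induction n with
    | zero =>
      have h := hf 1 1
      rw [mul_one] at h
      have h0 : f 1 = 0 := left_eq_add.1 h
      exact ⟨rfl, by simp [h0, bil_apply]⟩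
    | succ n ih =>
      rw [pow_succ]
      refine ⟨?_, ?_⟩
      · rw [Subgroup.coe_mul, LinearEquiv.mul_apply, hs, ih.1]
      · have h := (hG (s ^ n).2).1 (f s) v
        rw [ih.1] at h
        rw [hf, bil_add_left, h, ih.2]
        push_cast
        ring
  have h := (hpow (orderOf s)).2
  have h1 := (hpow 0).2
  rw [pow_zero, Nat.cast_zero, zero_mul] at h1
  rw [pow_orderOf_eq_one, h1] at h
  exact (mul_eq_zero.1 h.symm).resolve_left (by exact_mod_cast (orderOf_pos s).ne')

theorem exists_potential [Finite G] (hG : G ≤ W)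
    (hf : ∀ g h : G, f (g * h) = g.1 (f h) + f g) :
    ∃ t : V → ℤ, ∀ (g : G) (e : V), bil (f g) (g.1 e) = t (g.1 e) - t e := by
  let r : V → V := fun e => (Quotient.mk (MulAction.orbitRel G V) e).out
  have hr : ∀ e, ∃ h : G, h.1 (r e) = e := fun e => by
    have : (MulAction.orbitRel G V) e (r e) := (MulAction.orbitRel G V).symm (Quotient.mk_out e)
    obtain ⟨h, hh⟩ := MulAction.orbitRel_apply.1 this
    exact ⟨h, hh⟩
  choose k hk using hr
  have hbil : ∀ (g h : G) (v : V), bil (f (g * h)) (g.1 v) = bil (f h) v + bil (f g) (g.1 v) :=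
    fun g h v => by rw [hf, bil_add_left, (hG g.2).1]
  refine ⟨fun e => bil (f (k e)) e, fun g e => ?_⟩
  have hre : r (g.1 e) = r e :=
    congrArg Quotient.out (Quotient.sound (MulAction.orbitRel_apply.2 ⟨g, rfl⟩))
  have hs : ((g * k e)⁻¹ * k (g.1 e)).1 (r e) = r e := by
    have h1 : (g * k e).1 (r e) = g.1 e := by
      rw [Subgroup.coe_mul, LinearEquiv.mul_apply, hk]
    have h2 : (k (g.1 e)).1 (r e) = g.1 e := by rw [← hre, hk]
    rw [Subgroup.coe_mul, LinearEquiv.mul_apply, h2, ← h1]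
    exact LinearEquiv.symm_apply_apply _ _
  have h3 := hbil (g * k e) ((g * k e)⁻¹ * k (g.1 e)) (r e)
  rw [mul_inv_cancel_left, bil_cocycle_eq_zero hG hf hs, zero_add, Subgroup.coe_mul,
    LinearEquiv.mul_apply, hk, hbil] at h3
  beta_reduce
  rw [h3]
  ring

theorem exists_frameOp_eq [Finite G] (hG : G ≤ W)
    (hf : ∀ g h : G, f (g * h) = g.1 (f h) + f g) (X : Finset V)
    (hX : ∀ g : G, ∀ e ∈ X, g.1 e ∈ X) : ∃ y, ∀ g : G, frameOp X (f g) = y - g.1 y := by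
  obtain ⟨t, ht⟩ := exists_potential hG hf
  refine ⟨∑ e ∈ X, t e • e, fun g => ?_⟩
  have hsum : ∀ φ : V → V, ∑ e ∈ X, φ e = ∑ e ∈ X, φ (g.1 e) := fun φ =>
    (Finset.sum_nbij' g.1 (g⁻¹).1 (hX g) (hX g⁻¹) (fun e _ => g.1.symm_apply_apply e)
      (fun e _ => g.1.apply_symm_apply e) fun _ _ => rfl).symm
  rw [frameOp_apply, hsum, map_sum, hsum fun e => t e • e, ← Finset.sum_sub_distrib]
  refine Finset.sum_congr rfl fun e _ => ?_
  rw [ht, map_smul, sub_smul]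

end Cocycle

theorem range_symRep_le_W : symRep.range ≤ W := by
  rintro _ ⟨σ, rfl⟩
  exact (symRep_actsAs σ).1

theorem map_mem_of_orb_eq {E : V} {X : Finset V} (h : orb symRep.range E = X) {g : LatAut}
    (hg : g ∈ symRep.range) {e : V} (he : e ∈ X) : g e ∈ X := by
  rw [← Finset.mem_coe, ← h] at *
  obtain ⟨g', hg', rfl⟩ := he
  exact ⟨g * g', mul_mem hg hg', rfl⟩

theorem map_mem_signOrbit {g : LatAut} (hg : g ∈ symRep.range) {e : V} (he : e ∈ signOrbit) :
    g e ∈ signOrbit := by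
  obtain ⟨σ, rfl⟩ := hg
  have h : ∀ ε : ℤˣ, signVec ε ∈ signOrbit := by decide +kernel
  rcases Finset.mem_insert.1 he with rfl | he
  · rw [(symRep_actsAs σ).2.2.2]
    exact h _
  · rw [Finset.mem_singleton.1 he, (symRep_actsAs σ).2.2.2]
    exact h _

theorem condH1_range_symRep : CondH1 symRep.range := by
  intro G hG
  have hW := hG.trans range_symRep_le_W
  have : Finite symRep.range := (Nat.card_ne_zero.1 (by rw [card_range_symRep]; decide)).2
  have : Finite G := Finite.of_injective _ (Subgroup.inclusion_injective hG)
  refine subsingleton_of_forall_eq 0 fun x => ?_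
  induction x using groupCohomology.H1_induction_on with | h x => ?_
  rw [groupCohomology.H1π_eq_zero_iff]
  let f : G → V := x
  have hf : ∀ g h : G, f (g * h) = g.1 (f h) + f g := (groupCohomology.mem_cocycles₁_iff x).1 x.2
  obtain ⟨y₁, h₁⟩ := exists_frameOp_eq hW hf fibreOrbit
    fun g e he => map_mem_of_orb_eq orb_pentVec (hG g.2) he
  obtain ⟨y₂, h₂⟩ := exists_frameOp_eq hW hf pairOrbit
    fun g e he => map_mem_of_orb_eq orb_pairVec (hG g.2) he
  obtain ⟨y₃, h₃⟩ := exists_frameOp_eq hW hf signOrbit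
    fun g e he => map_mem_signOrbit (hG g.2) he
  refine ⟨y₂ + y₃ - y₁, funext fun g => ?_⟩
  have hC : bil (f g) conicVec = 0 := by
    refine bil_cocycle_eq_zero hW hf ?_
    obtain ⟨σ, hσ⟩ := hG g.2
    rw [← hσ, (symRep_actsAs σ).2.1]
  have hK : bil (f g) Kvec = 0 := bil_cocycle_eq_zero hW hf (hW g.2).2
  change g.1 (y₂ + y₃ - y₁) - (y₂ + y₃ - y₁) = f g
  rw [eq_frameOp (f g), h₁, h₂, h₃, hC, hK, map_sub, map_add]
  module

theorem exists_dp2_S5_conic' :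
    ∃ G : Subgroup LatAut, G ≤ W ∧
      Nonempty (G ≃* Equiv.Perm (Fin 5)) ∧
      (orbs G).ncard = 5 ∧
      {S ∈ orbs G | S.ncard = 10}.ncard = 2 ∧
      {S ∈ orbs G | S.ncard = 12}.ncard = 3 ∧
      (∀ E ∈ Exc,
        ((orb G E).ncard = 10 → Nonempty (stab G E ≃* DihedralGroup 6)) ∧
        ((orb G E).ncard = 12 → Nonempty (stab G E ≃* DihedralGroup 5))) ∧
      MinimalAction G ∧
      (∃ C, IsConic C ∧ ∀ g ∈ G, g C = C) ∧
      CondH1 G := by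
  refine ⟨symRep.range, range_symRep_le_W, ⟨(MonoidHom.ofInjective symRep_injective).symm⟩,
    ncard_orbs, ?_, ?_, fun E hE => ?_, minimalAction_range_symRep,
    ⟨conicVec, ⟨by decide +kernel, by decide +kernel⟩, ?_⟩, condH1_range_symRep⟩
  · rw [ncard_orbs_filter]; decide
  · rw [ncard_orbs_filter]; decide
  · obtain ⟨k, hk, horb⟩ := exists_orb_eq hE
    rw [horb, Set.ncard_coe_finset, card_excOrbit]
    refine ⟨fun h => nonempty_stab_mulEquiv_pair ?_ hk,
      fun h => nonempty_stab_mulEquiv_pent ?_ hk⟩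
    · by_contra hlt
      simp [hlt] at h
    · intro hlt
      simp [hlt] at h
  · rintro _ ⟨σ, rfl⟩
    exact (symRep_actsAs σ).2.1

end
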